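/- arXiv:2411.04391 — 3 statements merged into one kernel-verified Lean document; each statement's English description precedes it below -/
import Mathlib

section
/- (MultiFit achieves 15/13 on bivalued instances.) Let v be a bivalued cost function with values s < l on a finite set M of chores, and suppose M can be partitioned into n bundles each of cost at most μ. Then FFD(M, v, (15/13)·μ) allocates all chores into at most n bins. -/
open Finset

variable {α : Type*} [DecidableEq α]

/-- The total cost of a bundle `S` of chores under the additive cost function `v`. -/
def bundleCost (v : α → ℚ) (S : Finset α) : ℚ := ∑ c ∈ S, v c

/-- `P` is a partition of `M` into `d` (possibly empty) bundles. -/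
def IsPartitionInto (M : Finset α) (d : ℕ) (P : Fin d → Finset α) : Prop :=
  (∀ j, P j ⊆ M) ∧ (∀ j k, j ≠ k → Disjoint (P j) (P k)) ∧ ∀ c ∈ M, ∃ j, c ∈ P j

/-- `μ` is the `d`-maximin share `MMS^d(v, M)`: the minimum, over all partitions of `M`
into `d` bundles, of the maximum bundle cost. -/
def IsMMS (v : α → ℚ) (M : Finset α) (d : ℕ) (μ : ℚ) : Prop :=
  (∃ P : Fin d → Finset α, IsPartitionInto M d P ∧ ∀ j, bundleCost v (P j) ≤ μ) ∧
    ∀ P : Fin d → Finset α, IsPartitionInto M d P → ∃ j, μ ≤ bundleCost v (P j)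

/-- Insert chore `c` into the first bin of the list whose cost stays at most `τ`;
open a new bin if it fits in no existing bin (and fits in an empty bin). -/
def ffdInsert (v : α → ℚ) (τ : ℚ) (c : α) : List (Finset α) → List (Finset α)
  | [] => if v c ≤ τ then [{c}] else []
  | B :: rest =>
      if bundleCost v B + v c ≤ τ then insert c B :: rest
      else B :: ffdInsert v τ c rest

/-- The list of bins produced by FFD with threshold `τ` on the list `L` of chores
(processed in the order of `L`). -/
def ffdBins (v : α → ℚ) (τ : ℚ) (L : List α) : List (Finset α) :=
  L.foldl (fun bins c => ffdInsert v τ c bins) []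

/-- `L` is a valid FFD processing order for `(M, v)`: an enumeration of `M`
in non-increasing order of cost. -/
def IsFFDList (v : α → ℚ) (M : Finset α) (L : List α) : Prop :=
  L.toFinset = M ∧ L.Nodup ∧ L.Pairwise fun c c' => v c' ≤ v c

/-- FFD allocates all the chores into (at most) `n` bins. -/
def FFDAllocatesInto (v : α → ℚ) (τ : ℚ) (L : List α) (n : ℕ) : Prop :=
  (ffdBins v τ L).length ≤ n ∧ ∀ c ∈ L, ∃ B ∈ ffdBins v τ L, c ∈ B

/-- `v` is bivalued on `M` with values `s < l`. -/
def Bivalued (v : α → ℚ) (M : Finset α) (s l : ℚ) : Prop :=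
  0 < s ∧ s < l ∧ ∀ c ∈ M, v c = s ∨ v c = l


/-! ### Numeric facts -/

theorem nat_lt_of_mul_lt {x y : ℕ} {s : ℚ} (hs : 0 < s) (h : (x : ℚ) * s < y * s) : x < y := by
  have := lt_of_mul_lt_mul_right h hs.le
  exact_mod_cast this

theorem num_bounds (s l τ : ℚ) (hs : 0 < s) (hl : s < l) (hτ : 2 * τ < 15 * s)
    (k g0 gk : ℕ)
    (hg0 : (g0 : ℚ) * s ≤ τ) (hg0' : τ < (g0 + 1) * s)
    (hgk : (k : ℚ) * l + gk * s ≤ τ) : g0 ≤ 7 ∧ gk + k ≤ g0 := by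
  constructor
  · have : g0 < 8 := by
      apply nat_lt_of_mul_lt hs
      push_cast
      linarith
    omega
  · have hkl : (k : ℚ) * s ≤ k * l := by gcongr
    have : gk + k < g0 + 1 := by
      apply nat_lt_of_mul_lt hs
      push_cast
      linarith
    omega

set_option maxHeartbeats 4000000 in
theorem num_opt (s l μ : ℚ) (hs : 0 < s) (hl : s < l) (hμ : 2 * μ < 13 * s)
    (k g0 gk a F : ℕ) (hk0 : 0 < k) (hk : (k : ℚ) * l ≤ 15 / 13 * μ)
    (hk' : 15 / 13 * μ < (k + 1) * l)
    (hg0 : (g0 : ℚ) * s ≤ 15 / 13 * μ) (hg0' : 15 / 13 * μ < (g0 + 1) * s)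
    (hgk : (k : ℚ) * l + gk * s ≤ 15 / 13 * μ) (hgk' : 15 / 13 * μ < k * l + (gk + 1) * s)
    (haF : (a : ℚ) * l + F * s ≤ μ) : k * F + a * (g0 - gk) ≤ k * g0 := by
  obtain ⟨h7, hkg⟩ := num_bounds s l (15 / 13 * μ) hs hl (by linarith) k g0 gk hg0 hg0' hgk
  have hl0 : 0 < l := hs.trans hl
  have hμ0 : 0 ≤ μ := le_trans (by positivity) haF
  have hak : a ≤ k := by
    have : a < k + 1 := by
      apply nat_lt_of_mul_lt hl0
      push_cast
      have : (0 : ℚ) ≤ F * s := by positivity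
      linarith
    omega
  by_contra hcon
  have hF : (k * g0 - a * (g0 - gk)) / k + 1 ≤ F := by
    apply Nat.div_lt_of_lt_mul
    have : 0 < k * F := by
      have : a * (g0 - gk) ≤ k * g0 := Nat.mul_le_mul hak (by omega)
      omega
    omega
  have hF2 : (((k * g0 - a * (g0 - gk)) / k + 1 : ℕ) : ℚ) * s ≤ F * s := by
    gcongr
  have haF2 := add_le_add_right hF2 ((a : ℚ) * l) |>.trans haF
  clear hF hF2 haF hcon
  have hk7 : k ≤ 7 := by omega
  interval_cases k <;> interval_cases g0 <;> first | omega | skip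
  all_goals
    have hgk7 : gk ≤ 7 := by omega
    interval_cases gk <;> first | omega | skip
  all_goals
    interval_cases a <;>
      (linarith only [hs, hl, hμ, haF2, hk', hg0, hg0', hgk, hgk'])

set_option maxHeartbeats 4000000 in
theorem num_ffd (s l μ : ℚ) (hs : 0 < s) (hl : s < l) (hμ : 2 * μ < 13 * s)
    (k g0 gk r G : ℕ) (hr : r < k) (hk : (k : ℚ) * l ≤ 15 / 13 * μ)
    (hk' : 15 / 13 * μ < (k + 1) * l)
    (hg0 : (g0 : ℚ) * s ≤ 15 / 13 * μ) (hg0' : 15 / 13 * μ < (g0 + 1) * s)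
    (hgk : (k : ℚ) * l + gk * s ≤ 15 / 13 * μ) (hgk' : 15 / 13 * μ < k * l + (gk + 1) * s)
    (hrG : 15 / 13 * μ < (r : ℚ) * l + (G + 1) * s) :
    k * g0 + 1 ≤ k * G + r * (g0 - gk) + k := by
  obtain ⟨h7, hkg⟩ := num_bounds s l (15 / 13 * μ) hs hl (by linarith) k g0 gk hg0 hg0' hgk
  by_contra hcon
  have hG : G ≤ (k * g0 - r * (g0 - gk) - k) / k := by
    rw [Nat.le_div_iff_mul_le (by omega), mul_comm]
    omega
  have hG2 : ((G : ℕ) : ℚ) * s ≤ (((k * g0 - r * (g0 - gk) - k) / k : ℕ) : ℚ) * s := by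
    gcongr
  have hrG2 : 15 / 13 * μ < (r : ℚ) * l + ((((k * g0 - r * (g0 - gk) - k) / k : ℕ) : ℚ) * s + s) := by
    linarith
  clear hG hG2 hrG hcon
  have hk7 : k ≤ 7 := by omega
  interval_cases k <;> interval_cases g0 <;> first | omega | skip
  all_goals
    have hgk7 : gk ≤ 7 := by omega
    interval_cases gk <;> first | omega | skip
  all_goals
    interval_cases r <;>
      (linarith only [hs, hl, hμ, hrG2, hk', hg0, hg0', hgk, hgk'])

/-! ### Counting lemmas -/

/-- The number of chores of cost `x` in `B`. -/
def cnt (v : α → ℚ) (x : ℚ) (B : Finset α) : ℕ := ∑ c ∈ B, if v c = x then 1 else 0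

/-- The number of chores of cost `x` in the list `L`. -/
def lcnt (v : α → ℚ) (x : ℚ) (L : List α) : ℕ := (L.map fun c => if v c = x then 1 else 0).sum

theorem cost_eq_cnt (v : α → ℚ) (s l : ℚ) (hsl : s < l) (B : Finset α)
    (hB : ∀ c ∈ B, v c = s ∨ v c = l) :
    bundleCost v B = cnt v l B * l + cnt v s B * s := by
  unfold bundleCost cnt
  push_cast
  rw [Finset.sum_mul, Finset.sum_mul, ← Finset.sum_add_distrib]
  apply Finset.sum_congr rfl
  intro c hc
  rcases hB c hc with h | h
  · simp [h, hsl.ne]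
  · simp [h, hsl.ne']

theorem cnt_insert (v : α → ℚ) (x : ℚ) (c : α) (B : Finset α) (h : c ∉ B) :
    cnt v x (insert c B) = (if v c = x then 1 else 0) + cnt v x B := by
  unfold cnt
  rw [Finset.sum_insert h]

theorem cnt_partition (v : α → ℚ) (x : ℚ) (M : Finset α) (n : ℕ) (P : Fin n → Finset α)
    (hP : IsPartitionInto M n P) (L : List α) (hL : L.toFinset = M) (hnd : L.Nodup) :
    lcnt v x L = ∑ j, cnt v x (P j) := by
  obtain ⟨h1, h2, h3⟩ := hP
  have hM : M = Finset.univ.biUnion P := by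
    ext c
    simp only [Finset.mem_biUnion, Finset.mem_univ, true_and]
    exact ⟨h3 c, fun ⟨j, hj⟩ => h1 j hj⟩
  unfold lcnt cnt
  rw [← Finset.sum_biUnion (fun j _ k _ hjk => h2 j k hjk), ← hM, ← hL, List.sum_toFinset _ hnd]

/-! ### The core counting inequality -/

theorem list_zero (g0 : ℕ) (bins : List (ℕ × ℕ))
    (h : ∀ p ∈ bins, p.1 = 0 ∧ g0 ≤ p.2) :
    bins.length * g0 ≤ (bins.map Prod.snd).sum ∧ (bins.map Prod.fst).sum = 0 := by
  induction bins with
  | nil => simp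
  | cons p t ih =>
    have h1 := h p (by simp)
    have h2 := ih (fun q hq => h q (by simp [hq]))
    simp only [List.map_cons, List.sum_cons, List.length_cons]
    constructor
    · nlinarith
    · omega

theorem list_bound (k g0 D : ℕ) (hk0 : 0 < k) (bins : List (ℕ × ℕ))
    (hpw : bins.Pairwise fun p q => p.1 = k ∨ q.1 = 0)
    (hk : ∀ p ∈ bins, p.1 ≤ k)
    (h0 : ∀ p ∈ bins, p.1 = 0 → g0 ≤ p.2)
    (hkk : ∀ p ∈ bins, p.1 = k → g0 ≤ p.2 + D)
    (hr : ∀ p ∈ bins, p.1 < k → k * g0 + 1 ≤ k * p.2 + p.1 * D + k) :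
    k * (bins.length * g0) + 1 ≤
      k * (bins.map Prod.snd).sum + (bins.map Prod.fst).sum * D + k := by
  induction bins with
  | nil => simp; omega
  | cons p t ih =>
    rw [List.pairwise_cons] at hpw
    simp only [List.map_cons, List.sum_cons, List.length_cons]
    rcases (hk p (by simp)).eq_or_lt with hp | hp
    · have h1 := ih hpw.2 (fun q hq => hk q (by simp [hq])) (fun q hq => h0 q (by simp [hq]))
        (fun q hq => hkk q (by simp [hq])) (fun q hq => hr q (by simp [hq]))
      have h2 := Nat.mul_le_mul_left k (hkk p (by simp) hp)
      rw [hp]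
      nlinarith
    · have hz : ∀ q ∈ t, q.1 = 0 ∧ g0 ≤ q.2 := by
        intro q hq
        have h3 : q.1 = 0 := (hpw.1 q hq).resolve_left hp.ne
        exact ⟨h3, h0 q (by simp [hq]) h3⟩
      obtain ⟨h4, h5⟩ := list_zero g0 t hz
      have h6 := hr p (by simp) hp
      rw [h5]
      have h7 := Nat.mul_le_mul_left k h4
      nlinarith

theorem list_cost (s l μ : ℚ) (bins : List (ℕ × ℕ))
    (h : ∀ p ∈ bins, μ ≤ (p.1 : ℚ) * l + p.2 * s) :
    (bins.length : ℚ) * μ ≤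
      ((bins.map Prod.fst).sum : ℕ) * l + ((bins.map Prod.snd).sum : ℕ) * s := by
  induction bins with
  | nil => simp
  | cons p t ih =>
    have h1 := h p (by simp)
    have h2 := ih (fun q hq => h q (by simp [hq]))
    simp only [List.map_cons, List.sum_cons, List.length_cons]
    push_cast at h2 ⊢
    linarith

theorem core (s l μ : ℚ) (hs : 0 < s) (hl : s < l) (hμ0 : 0 ≤ μ) (k : ℕ)
    (hk : (k : ℚ) * l ≤ 15 / 13 * μ) (hk' : 15 / 13 * μ < (k + 1) * l)
    (n : ℕ) (a f : Fin n → ℕ) (haf : ∀ j, (a j : ℚ) * l + f j * s ≤ μ)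
    (bins : List (ℕ × ℕ)) (hn : bins.length = n)
    (hpw : bins.Pairwise fun p q => p.1 = k ∨ q.1 = 0)
    (hbk : ∀ p ∈ bins, p.1 ≤ k)
    (hfull : ∀ p ∈ bins, 15 / 13 * μ < (p.1 : ℚ) * l + (p.2 + 1) * s)
    (hA : (bins.map Prod.fst).sum = ∑ j, a j) :
    ∑ j, f j ≤ (bins.map Prod.snd).sum := by
  by_cases hμ : 13 * s ≤ 2 * μ
  · have h1 := list_cost s l μ bins (fun p hp => by have := hfull p hp; linarith)
    have h2 : ((∑ j, a j : ℕ) : ℚ) * l + ((∑ j, f j : ℕ) : ℚ) * s ≤ n * μ := by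
      push_cast
      rw [Finset.sum_mul, Finset.sum_mul, ← Finset.sum_add_distrib]
      calc _ ≤ ∑ _j : Fin n, μ := Finset.sum_le_sum (fun j _ => haf j)
        _ = n * μ := by simp
    rw [hA, hn] at h1
    have h3 : ((∑ j, f j : ℕ) : ℚ) * s ≤ ((bins.map Prod.snd).sum : ℕ) * s := by linarith
    have := le_of_mul_le_mul_right h3 hs
    exact_mod_cast this
  · push Not at hμ
    set τ := 15 / 13 * μ with hτ
    have hτ0 : 0 ≤ τ := by positivity
    have hl0 : 0 < l := hs.trans hl
    obtain ⟨g0, hg0, hg0'⟩ : ∃ g : ℕ, (g : ℚ) * s ≤ τ ∧ τ < (g + 1) * s := by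
      refine ⟨⌊τ / s⌋₊, ?_, ?_⟩
      · rw [← le_div_iff₀ hs]
        exact Nat.floor_le (by positivity)
      · rw [← div_lt_iff₀ hs]
        exact Nat.lt_floor_add_one _
    obtain ⟨gk, hgk, hgk'⟩ : ∃ g : ℕ, (k : ℚ) * l + g * s ≤ τ ∧ τ < k * l + (g + 1) * s := by
      have h0 : 0 ≤ τ - k * l := by linarith
      refine ⟨⌊(τ - k * l) / s⌋₊, ?_, ?_⟩
      · have : (⌊(τ - k * l) / s⌋₊ : ℚ) * s ≤ τ - k * l := by
          rw [← le_div_iff₀ hs]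
          exact Nat.floor_le (by positivity)
        linarith
      · have : τ - k * l < ((⌊(τ - k * l) / s⌋₊ : ℚ) + 1) * s := by
          rw [← div_lt_iff₀ hs]
          exact Nat.lt_floor_add_one _
        linarith
    have hgen : ∀ x t : ℕ, (x : ℚ) * s ≤ τ → τ < (t + 1) * s → x ≤ t := by
      intro x t h1 h2
      have : x < t + 1 := by
        apply nat_lt_of_mul_lt hs
        push_cast
        linarith
      omega
    have h0 : ∀ p ∈ bins, p.1 = 0 → g0 ≤ p.2 := by
      intro p hp h
      have := hfull p hp
      rw [h] at this
      exact hgen _ _ hg0 (by simpa using this)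
    rcases Nat.eq_zero_or_pos k with hk0 | hk0
    · obtain ⟨h1, -⟩ := list_zero g0 bins (fun p hp => by
        have h2 : p.1 = 0 := by have := hbk p hp; omega
        exact ⟨h2, h0 p hp h2⟩)
      rw [hn] at h1
      refine le_trans ?_ h1
      calc ∑ j, f j ≤ ∑ _j : Fin n, g0 := by
            apply Finset.sum_le_sum
            intro j _
            refine hgen _ _ ?_ hg0'
            have h2 := haf j
            have h3 : (0 : ℚ) ≤ a j * l := by positivity
            linarith
        _ = n * g0 := by simp
    · have hkk : ∀ p ∈ bins, p.1 = k → g0 ≤ p.2 + (g0 - gk) := by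
        intro p hp h
        have h1 := hfull p hp
        rw [h] at h1
        have : gk < p.2 + 1 := by
          apply nat_lt_of_mul_lt hs
          push_cast
          linarith
        omega
      have h1 := list_bound k g0 (g0 - gk) hk0 bins hpw hbk h0 hkk (fun p hp hlt =>
        num_ffd s l μ hs hl hμ k g0 gk p.1 p.2 hlt hk hk' hg0 hg0' hgk hgk' (hfull p hp))
      have h2 : ∑ j, (k * f j + a j * (g0 - gk)) ≤ ∑ _j : Fin n, k * g0 :=
        Finset.sum_le_sum (fun j _ =>
          num_opt s l μ hs hl hμ k g0 gk (a j) (f j) hk0 hk hk' hg0 hg0' hgk hgk' (haf j))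
      rw [Finset.sum_add_distrib, ← Finset.mul_sum, ← Finset.sum_mul] at h2
      simp only [Finset.sum_const, Finset.card_univ, Fintype.card_fin, smul_eq_mul] at h2
      rw [hA, hn] at h1
      have h3 : k * ∑ j, f j < k * ((bins.map Prod.snd).sum + 1) := by nlinarith
      have := Nat.lt_of_mul_lt_mul_left h3
      omega

/-! ### The FFD run -/

theorem ffdInsert_cases (v : α → ℚ) (τ : ℚ) (c : α) (hc : v c ≤ τ) (bins : List (Finset α)) :
    ((∀ B ∈ bins, τ < bundleCost v B + v c) ∧ ffdInsert v τ c bins = bins ++ [{c}]) ∨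
    ∃ X B Y, bins = X ++ B :: Y ∧ (∀ B' ∈ X, τ < bundleCost v B' + v c) ∧
      bundleCost v B + v c ≤ τ ∧ ffdInsert v τ c bins = X ++ insert c B :: Y := by
  induction bins with
  | nil => left; simp [ffdInsert, hc]
  | cons B t ih =>
    by_cases h : bundleCost v B + v c ≤ τ
    · right
      exact ⟨[], B, t, by simp, by simp, h, by simp [ffdInsert, h]⟩
    · rcases ih with ⟨h1, h2⟩ | ⟨X, B', Y, h1, h2, h3, h4⟩
      · left
        refine ⟨?_, by simp [ffdInsert, h, h2]⟩
        intro B' hB'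
        rcases List.mem_cons.1 hB' with rfl | hB'
        · exact not_le.1 h
        · exact h1 _ hB'
      · right
        refine ⟨B :: X, B', Y, by simp [h1], ?_, h3, by simp [ffdInsert, h, h4]⟩
        intro B'' hB''
        rcases List.mem_cons.1 hB'' with rfl | hB''
        · exact not_le.1 h
        · exact h2 _ hB''

/-- The invariant of the FFD run. -/
structure FInv (v : α → ℚ) (s l τ : ℚ) (k n : ℕ) (L : List α) (bins : List (Finset α)) : Prop where
  sub : ∀ B ∈ bins, ∀ c ∈ B, c ∈ L
  cover : ∀ c ∈ L, ∃ B ∈ bins, c ∈ B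
  len : bins.length ≤ n
  large : (bins.map (cnt v l)).sum = lcnt v l L
  small : (bins.map (cnt v s)).sum = lcnt v s L
  pw : bins.Pairwise fun B B' => cnt v l B = k ∨ cnt v l B' = 0
  cost : ∀ B ∈ bins, (cnt v l B : ℚ) * l + cnt v s B * s ≤ τ

theorem sum_zero_mem {β : Type*} (g : β → ℕ) (bins : List β) (h : (bins.map g).sum = 0) :
    ∀ B ∈ bins, g B = 0 := by
  intro B hB
  rw [List.sum_eq_zero_iff] at h
  exact h _ (List.mem_map_of_mem hB)

theorem run_inv (v : α → ℚ) (s l μ : ℚ) (hs : 0 < s) (hl : s < l) (hμ0 : 0 ≤ μ) (k n : ℕ)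
    (hk : (k : ℚ) * l ≤ 15 / 13 * μ) (hk' : 15 / 13 * μ < (k + 1) * l)
    (a f : Fin n → ℕ) (haf : ∀ j, (a j : ℚ) * l + f j * s ≤ μ)
    (L : List α) (hv : ∀ c ∈ L, v c = s ∨ v c = l) (hvμ : ∀ c ∈ L, v c ≤ μ)
    (hnd : L.Nodup) (hpw : L.Pairwise fun c c' => v c' ≤ v c)
    (hA : lcnt v l L = ∑ j, a j) (hS : lcnt v s L = ∑ j, f j) :
    ∀ L₁ L₂ : List α, L = L₁ ++ L₂ →
      FInv v s l (15 / 13 * μ) k n L₁ (ffdBins v (15 / 13 * μ) L₁) := by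
  intro L₁
  have hl0 : 0 < l := hs.trans hl
  set τ := 15 / 13 * μ with hτ
  induction L₁ using List.reverseRecOn with
  | nil =>
    intro L₂ _
    constructor <;> simp [ffdBins, lcnt]
  | append_singleton L₁ c ih =>
    intro L₂ hLe
    have hLe' : L = L₁ ++ (c :: L₂) := by simpa using hLe
    have I := ih (c :: L₂) hLe'
    have hbins : ffdBins v τ (L₁ ++ [c]) = ffdInsert v τ c (ffdBins v τ L₁) := by
      simp [ffdBins, List.foldl_append]
    rw [hbins]
    generalize ffdBins v τ L₁ = bins at I
    clear hbins ih
    have hcL : c ∈ L := by simp [hLe']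
    have hcL₁ : c ∉ L₁ := by
      rw [hLe', List.nodup_append] at hnd
      intro h
      exact hnd.2.2 c h c (by simp) rfl
    have hcτ : v c ≤ τ := by
      have := hvμ c hcL
      linarith
    have hcost : ∀ B ∈ bins, bundleCost v B = cnt v l B * l + cnt v s B * s := by
      intro B hB
      apply cost_eq_cnt v s l hl
      intro c' hc'
      apply hv
      rw [hLe']
      simp [I.sub B hB c' hc']
    have hk_of : ∀ x : ℕ, (x : ℚ) * l ≤ τ → x ≤ k := by
      intro x hx
      have : x < k + 1 := by
        apply nat_lt_of_mul_lt hl0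
        push_cast
        linarith
      omega
    have hbk : ∀ B ∈ bins, cnt v l B ≤ k := by
      intro B hB
      apply hk_of
      have h1 := I.cost B hB
      have h2 : (0 : ℚ) ≤ cnt v s B * s := by positivity
      linarith
    have hcntA : ∀ x, lcnt v x L = lcnt v x L₁ + (if v c = x then 1 else 0) + lcnt v x L₂ := by
      intro x
      simp [lcnt, hLe', add_assoc]
    have hcnt1 : ∀ x, lcnt v x (L₁ ++ [c]) = lcnt v x L₁ + (if v c = x then 1 else 0) := by
      intro x
      simp [lcnt]
    rw [hLe', List.pairwise_append, List.pairwise_cons] at hpw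
    -- if `c` is large then there are no small chores so far
    have hlarge : v c = l → ∀ B ∈ bins, cnt v s B = 0 := by
      intro hc
      apply sum_zero_mem
      rw [I.small]
      unfold lcnt
      rw [List.sum_eq_zero_iff]
      intro x hx
      obtain ⟨d, hd, rfl⟩ := List.mem_map.1 hx
      have h1 := hpw.2.2 d hd c (by simp)
      rw [if_neg]
      intro h
      linarith
    -- if `c` is small then all large chores are placed
    have hsmall : v c = s → lcnt v l L = lcnt v l L₁ := by
      intro hc
      rw [hcntA, if_neg (by rw [hc]; exact hl.ne)]
      have : lcnt v l L₂ = 0 := by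
        unfold lcnt
        rw [List.sum_eq_zero_iff]
        intro x hx
        obtain ⟨d, hd, rfl⟩ := List.mem_map.1 hx
        have h1 := hpw.2.1.1 d hd
        rw [if_neg]
        intro h
        linarith
      omega
    rcases ffdInsert_cases v τ c hcτ bins with ⟨hfail, heq⟩ | ⟨X, B, Y, hXY, hX, hB, heq⟩
    · -- a new bin is opened
      rw [heq]
      have hlt : bins.length < n := by
        refine lt_of_le_of_ne I.len ?_
        intro hn
        rcases hv c hcL with hc | hc
        · have h1 := core s l μ hs hl hμ0 k hk hk' n a f haf
            (bins.map fun B => (cnt v l B, cnt v s B)) (by simpa using hn)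
            (by
              rw [List.pairwise_map]
              exact I.pw)
            (by
              intro p hp
              obtain ⟨B, hB, rfl⟩ := List.mem_map.1 hp
              exact hbk B hB)
            (by
              intro p hp
              obtain ⟨B, hB, rfl⟩ := List.mem_map.1 hp
              have h1 := hfail B hB
              rw [hcost B hB, hc] at h1
              simp only
              linarith)
            (by
              rw [List.map_map, ← hA, hsmall hc, ← I.large]
              rfl)
          rw [List.map_map, ← hS, hcntA, if_pos hc] at h1
          have h2 : (bins.map (Prod.snd ∘ fun B => (cnt v l B, cnt v s B))).sum = lcnt v s L₁ := by
            rw [← I.small]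
            rfl
          omega
        · have hall : ∀ B ∈ bins, cnt v l B = k := by
            intro B hB
            have h1 := hfail B hB
            rw [hcost B hB, hlarge hc B hB, hc] at h1
            have h2 := hbk B hB
            have h3 : k < cnt v l B + 1 := by
              apply nat_lt_of_mul_lt hl0
              push_cast at h1 ⊢
              linarith
            omega
          have h4 : (bins.map (cnt v l)).sum = n * k := by
            rw [List.map_congr_left hall]
            simp [hn]
          have h5 : ∑ j, a j ≤ ∑ _j : Fin n, k := by
            apply Finset.sum_le_sum
            intro j _
            apply hk_of
            have h1 := haf j
            have h2 : (0 : ℚ) ≤ f j * s := by positivity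
            linarith
          simp only [Finset.sum_const, Finset.card_univ, Fintype.card_fin, smul_eq_mul] at h5
          rw [← hA, hcntA, if_pos hc, ← I.large, h4] at h5
          omega
      have hsing : ∀ x, cnt v x {c} = if v c = x then 1 else 0 := by
        intro x
        rw [cnt, Finset.sum_singleton]
      refine ⟨?_, ?_, ?_, ?_, ?_, ?_, ?_⟩
      · intro B hB d hd
        rcases List.mem_append.1 hB with hB | hB
        · simp [I.sub B hB d hd]
        · rw [List.mem_singleton] at hB
          subst hB
          rw [Finset.mem_singleton] at hd
          simp [hd]
      · intro d hd
        rcases List.mem_append.1 hd with hd | hd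
        · obtain ⟨B, hB, hdB⟩ := I.cover d hd
          exact ⟨B, by simp [hB], hdB⟩
        · exact ⟨{c}, by simp, by simpa using hd⟩
      · simpa using hlt
      · rw [hcnt1, ← I.large, List.map_append, List.sum_append]
        simp [hsing]
      · rw [hcnt1, ← I.small, List.map_append, List.sum_append]
        simp [hsing]
      · rw [List.pairwise_append]
        refine ⟨I.pw, by simp, ?_⟩
        intro B hB B' hB'
        rw [List.mem_singleton] at hB'
        subst hB'
        rcases hv c hcL with hc | hc
        · right
          rw [hsing, if_neg (by rw [hc]; exact hl.ne)]
        · left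
          have h1 := hfail B hB
          rw [hcost B hB, hlarge hc B hB, hc] at h1
          have h2 := hbk B hB
          have h3 : k < cnt v l B + 1 := by
            apply nat_lt_of_mul_lt hl0
            push_cast at h1 ⊢
            linarith
          omega
      · intro B hB
        rcases List.mem_append.1 hB with hB | hB
        · exact I.cost B hB
        · rw [List.mem_singleton] at hB
          subst hB
          rw [hsing, hsing]
          rcases hv c hcL with hc | hc
          · simpa [hc, hl.ne] using hc ▸ hcτ
          · simpa [hc, hl.ne'] using hc ▸ hcτ
    · -- `c` goes into an existing bin
      rw [heq]
      have hBm : B ∈ bins := by simp [hXY]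
      have hcB : c ∉ B := fun h => hcL₁ (I.sub B hBm c h)
      have hsum : ∀ x, ((X ++ insert c B :: Y).map (cnt v x)).sum
          = (bins.map (cnt v x)).sum + (if v c = x then 1 else 0) := by
        intro x
        rw [hXY]
        simp only [List.map_append, List.map_cons, List.sum_append, List.sum_cons,
          cnt_insert v x c B hcB]
        omega
      have hmem : ∀ B' ∈ X ++ insert c B :: Y, B' ∈ bins ∨ B' = insert c B := by
        intro B' hB'
        rw [hXY]
        simp only [List.mem_append, List.mem_cons] at hB' ⊢
        tauto
      refine ⟨?_, ?_, ?_, ?_, ?_, ?_, ?_⟩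
      · intro B' hB' d hd
        rcases hmem B' hB' with h | h
        · simp [I.sub B' h d hd]
        · subst h
          rcases Finset.mem_insert.1 hd with hd | hd
          · simp [hd]
          · simp [I.sub B hBm d hd]
      · intro d hd
        rcases List.mem_append.1 hd with hd | hd
        · obtain ⟨B', hB', hdB⟩ := I.cover d hd
          rw [hXY] at hB'
          simp only [List.mem_append, List.mem_cons] at hB'
          rcases hB' with h | h | h
          · exact ⟨B', by simp [h], hdB⟩
          · exact ⟨insert c B, by simp, by rw [← h]; exact Finset.mem_insert_of_mem hdB⟩
          · exact ⟨B', by simp [h], hdB⟩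
        · exact ⟨insert c B, by simp, by rw [List.mem_singleton] at hd; simp [hd]⟩
      · have := I.len
        rw [hXY] at this
        simpa using this
      · rw [hcnt1, ← I.large, hsum]
      · rw [hcnt1, ← I.small, hsum]
      · have hp := I.pw
        rw [hXY, List.pairwise_append, List.pairwise_cons] at hp
        obtain ⟨p1, ⟨p2, p3⟩, p4⟩ := hp
        rw [List.pairwise_append, List.pairwise_cons]
        rcases hv c hcL with hc | hc
        · have hs' : cnt v l (insert c B) = cnt v l B := by
            rw [cnt_insert v l c B hcB, if_neg (by rw [hc]; exact hl.ne), zero_add]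
          refine ⟨p1, ⟨?_, p3⟩, ?_⟩
          · intro B' hB'
            rw [hs']
            exact p2 B' hB'
          · intro B₁ hB₁ B' hB'
            rcases List.mem_cons.1 hB' with h | h
            · rw [h, hs']
              exact p4 B₁ hB₁ B (by simp)
            · exact p4 B₁ hB₁ B' (by simp [h])
        · refine ⟨p1, ⟨?_, p3⟩, ?_⟩
          · intro B' hB'
            right
            refine (p2 B' hB').resolve_left ?_
            intro h
            rw [hcost B hBm, hlarge hc B hBm, hc, h] at hB
            push_cast at hB
            linarith
          · intro B₁ hB₁ B' hB'
            left
            have hm : B₁ ∈ bins := by simp [hXY, hB₁]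
            have h1 := hX B₁ hB₁
            rw [hcost B₁ hm, hlarge hc B₁ hm, hc] at h1
            have h2 := hbk B₁ hm
            have h3 : k < cnt v l B₁ + 1 := by
              apply nat_lt_of_mul_lt hl0
              push_cast at h1 ⊢
              linarith
            omega
      · intro B' hB'
        rcases hmem B' hB' with h | h
        · exact I.cost B' h
        · subst h
          rw [cnt_insert v l c B hcB, cnt_insert v s c B hcB]
          rw [hcost B hBm] at hB
          push_cast
          rcases hv c hcL with hc | hc
          · rw [hc] at hB
            simp only [hc, hl.ne, if_true, if_false]
            linarith
          · rw [hc] at hB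
            simp only [hc, hl.ne', if_true, if_false]
            linarith

/-- MultiFit achieves 15/13 on bivalued instances: for a bivalued cost
function, if `M` can be partitioned into `n` bundles each of cost at most `μ`, then FFD
with threshold `(15/13)·μ` allocates all chores into at most `n` bins. -/
theorem ffd_bivalued_15_13
    (M : Finset α) (v : α → ℚ) (s l : ℚ) (hbv : Bivalued v M s l)
    (n : ℕ) (μ : ℚ)
    (hpart : ∃ P : Fin n → Finset α, IsPartitionInto M n P ∧ ∀ j, bundleCost v (P j) ≤ μ)
    (L : List α) (hL : IsFFDList v M L) :
    FFDAllocatesInto v (15 / 13 * μ) L n := by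
  obtain ⟨hs, hl, hv⟩ := hbv
  obtain ⟨P, hP, hcost⟩ := hpart
  obtain ⟨hLM, hnd, hpw⟩ := hL
  rcases L.eq_nil_or_concat with hnil | ⟨L', c₀, hL'⟩
  · subst hnil
    simp [FFDAllocatesInto, ffdBins]
  have hmemM : ∀ c ∈ L, c ∈ M := by
    intro c hc
    rw [← hLM]
    simpa using hc
  have hvμ : ∀ c ∈ L, v c ≤ μ := by
    intro c hc
    obtain ⟨j, hj⟩ := hP.2.2 c (hmemM c hc)
    refine le_trans ?_ (hcost j)
    apply Finset.single_le_sum (f := v) _ hj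
    intro d hd
    rcases hv d (hP.1 j hd) with h | h <;> rw [h] <;> linarith
  have hc₀ : c₀ ∈ L := by simp [hL']
  have hμ0 : 0 ≤ μ := by
    have h1 := hvμ c₀ hc₀
    rcases hv c₀ (hmemM c₀ hc₀) with h | h <;> linarith
  have hl0 : 0 < l := hs.trans hl
  have hk : ((⌊15 / 13 * μ / l⌋₊ : ℕ) : ℚ) * l ≤ 15 / 13 * μ := by
    rw [← le_div_iff₀ hl0]
    exact Nat.floor_le (by positivity)
  have hk' : 15 / 13 * μ < ((⌊15 / 13 * μ / l⌋₊ : ℕ) + 1) * l := by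
    rw [← div_lt_iff₀ hl0]
    exact Nat.lt_floor_add_one _
  have I := run_inv v s l μ hs hl hμ0 _ n hk hk' (fun j => cnt v l (P j)) (fun j => cnt v s (P j))
    (by
      intro j
      rw [← cost_eq_cnt v s l hl (P j) (fun c hc => hv c (hP.1 j hc))]
      exact hcost j)
    L (fun c hc => hv c (hmemM c hc)) hvμ hnd hpw
    (cnt_partition v l M n P hP L hLM hnd) (cnt_partition v s M n P hP L hLM hnd) L [] (by simp)
  exact ⟨I.len, I.cover⟩
end

section
/- (Tightness of the 15/13 ratio.) Let M consist of 12 chores: 3 chores of cost 4 and 9 chores of cost 3, with cost function v. Then MMS^3(v, M) = 13, and for every threshold τ with 13 ≤ τ < 15, FFD(M, v, τ) does not allocate all chores into 3 bins (FFD packs the three chores of cost 4 into one bin and at most eight chores of cost 3 into the next two bins, leaving a chore unallocated). -/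
open Finset

variable {α : Type*} [DecidableEq α]

/-- FFD insertion seen only through bin costs. -/
def costInsert (τ x : ℚ) : List ℚ → List ℚ
  | [] => if x ≤ τ then [x] else []
  | b :: rest => if b + x ≤ τ then (b + x) :: rest else b :: costInsert τ x rest

lemma map_ffdInsert (v : α → ℚ) (τ : ℚ) (c : α) (bins : List (Finset α))
    (h : ∀ B ∈ bins, c ∉ B) :
    (ffdInsert v τ c bins).map (bundleCost v) = costInsert τ (v c) (bins.map (bundleCost v)) := by
  induction bins with
  | nil =>
    simp only [ffdInsert, List.map_nil, costInsert]
    split_ifs <;> simp [bundleCost]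
  | cons B rest ih =>
    have hB : c ∉ B := h B (by simp)
    have ih := ih (fun B' hB' => h B' (by simp [hB']))
    simp only [ffdInsert, List.map_cons, costInsert]
    split_ifs
    · simp [bundleCost, Finset.sum_insert hB, add_comm]
    · simp [ih]

lemma mem_ffdInsert (v : α → ℚ) (τ : ℚ) (c x : α) (bins : List (Finset α))
    (h : ∃ B ∈ ffdInsert v τ c bins, x ∈ B) : x = c ∨ ∃ B ∈ bins, x ∈ B := by
  induction bins with
  | nil =>
    simp only [ffdInsert] at h
    split_ifs at h <;> simp_all
  | cons B rest ih =>
    simp only [ffdInsert] at h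
    split_ifs at h
    · simp at h ⊢; tauto
    · simp only [List.mem_cons, exists_eq_or_imp] at h ⊢
      rcases h with h | h
      · exact Or.inr (Or.inl h)
      · rcases ih h with h | h
        · exact Or.inl h
        · exact Or.inr (Or.inr h)

lemma map_foldl_ffd (v : α → ℚ) (τ : ℚ) (L : List α) (hL : L.Nodup) (bins : List (Finset α))
    (h : ∀ c ∈ L, ∀ B ∈ bins, c ∉ B) :
    (L.foldl (fun bins c => ffdInsert v τ c bins) bins).map (bundleCost v) =
      (L.map v).foldl (fun b x => costInsert τ x b) (bins.map (bundleCost v)) := by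
  induction L generalizing bins with
  | nil => simp
  | cons a L ih =>
    rw [List.nodup_cons] at hL
    simp only [List.foldl_cons, List.map_cons]
    rw [ih hL.2, map_ffdInsert _ _ _ _ (h a (by simp))]
    intro c hc B hB hcB
    rcases mem_ffdInsert v τ a c bins ⟨B, hB, hcB⟩ with rfl | ⟨B', h1, h2⟩
    · exact hL.1 hc
    · exact h c (by simp [hc]) B' h1 h2

/-- Tightness of 15/13: for the instance with 3 chores of cost 4 and
9 chores of cost 3, the 3-maximin share is 13, yet FFD with any threshold
`13 ≤ τ < 15` fails to allocate all chores into 3 bins. -/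
theorem ffd_15_13_tight
    (M : Finset α) (v : α → ℚ)
    (T : Finset α) (hT : T ⊆ M) (hTcard : T.card = 3) (hMcard : M.card = 12)
    (hbig : ∀ c ∈ T, v c = 4) (hsmall : ∀ c ∈ M \ T, v c = 3) :
    IsMMS v M 3 13 ∧
      ∀ τ : ℚ, 13 ≤ τ → τ < 15 →
        ∀ L : List α, IsFFDList v M L → ¬ FFDAllocatesInto v τ L 3 := by
  have hsub : ∀ S ⊆ M \ T, bundleCost v S = 3 * S.card := by
    intro S hS
    unfold bundleCost
    rw [Finset.sum_congr rfl (fun c hc => hsmall c (hS hc))]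
    simp [mul_comm]
  have hUcard : (M \ T).card = 9 := by
    rw [Finset.card_sdiff_of_subset hT]; omega
  refine ⟨⟨?_, ?_⟩, ?_⟩
  · obtain ⟨a, b, c, hab, hac, hbc, rfl⟩ := Finset.card_eq_three.mp hTcard
    obtain ⟨U1, hU1, h1⟩ := Finset.exists_subset_card_eq (s := M \ {a, b, c}) (n := 3) (by omega)
    have hc2 : ((M \ {a, b, c}) \ U1).card = 6 := by
      rw [Finset.card_sdiff_of_subset hU1]; omega
    obtain ⟨U2, hU2, h2⟩ :=
      Finset.exists_subset_card_eq (s := (M \ {a, b, c}) \ U1) (n := 3) (by omega)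
    have hc3 : (((M \ {a, b, c}) \ U1) \ U2).card = 3 := by
      rw [Finset.card_sdiff_of_subset hU2]; omega
    obtain ⟨U3, hU3⟩ : ∃ U3, U3 = ((M \ {a, b, c}) \ U1) \ U2 := ⟨_, rfl⟩
    rw [← hU3] at hc3
    have hs2 : U2 ⊆ M \ {a, b, c} := hU2.trans Finset.sdiff_subset
    have hs3 : U3 ⊆ M \ {a, b, c} := by
      rw [hU3]; exact Finset.sdiff_subset.trans Finset.sdiff_subset
    have key : ∀ x ∈ ({a, b, c} : Finset α), ∀ S ⊆ M \ {a, b, c}, S.card = 3 →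
        bundleCost v (insert x S) ≤ 13 := by
      intro x hx S hS hcard
      have hxS : x ∉ S := fun h => (Finset.mem_sdiff.mp (hS h)).2 hx
      have := hsub S hS
      unfold bundleCost at this ⊢
      rw [Finset.sum_insert hxS, this, hcard, hbig x hx]
      norm_num
    refine ⟨![insert a U1, insert b U2, insert c U3], ⟨?_, ?_, ?_⟩, ?_⟩
    · clear key hsub hbig hsmall h1 h2 hc2 hc3 hUcard hTcard hMcard
      intro j x hx
      fin_cases j <;> simp at hx <;> grind
    · clear key hsub hbig hsmall h1 h2 hc2 hc3 hUcard hTcard hMcard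
      intro j k hjk
      rw [Finset.disjoint_left]
      intro x hx hy
      fin_cases j <;> fin_cases k <;> simp at hx hy hjk <;> grind
    · clear key hsub hbig hsmall h1 h2 hc2 hc3 hUcard hTcard hMcard
      intro x hx
      simp only [Fin.exists_fin_succ]
      simp
      grind
    · intro j
      fin_cases j
      · exact key a (by simp) U1 hU1 h1
      · exact key b (by simp) U2 hs2 h2
      · exact key c (by simp) U3 hs3 hc3
  · rintro P ⟨hP1, hP2, hP3⟩
    by_contra! hcon
    have hM : M = Finset.univ.biUnion P := by
      ext x
      simp only [Finset.mem_biUnion, Finset.mem_univ, true_and]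
      exact ⟨hP3 x, fun ⟨j, hj⟩ => hP1 j hj⟩
    have hsum : ∑ x ∈ M, v x = ∑ j, bundleCost v (P j) := by
      conv_lhs => rw [hM]
      exact Finset.sum_biUnion (fun j _ k _ h => hP2 j k h)
    have htot : ∑ x ∈ M, v x = 39 := by
      rw [← Finset.sum_sdiff hT, Finset.sum_congr rfl hsmall, Finset.sum_congr rfl hbig]
      simp [hUcard, hTcard]
      norm_num
    rw [htot, Fin.sum_univ_three] at hsum
    linarith [hcon 0, hcon 1, hcon 2]
  · rintro τ h13 h15 L ⟨hLM, hnd, hsort⟩ ⟨hlen, -⟩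
    have hperm : (L.map v).Perm (List.replicate 3 4 ++ List.replicate 9 3) := by
      have h1 : (T.toList ++ (M \ T).toList).Perm L := by
        refine (List.perm_ext_iff_of_nodup ?_ hnd).mpr ?_
        · refine List.Nodup.append (Finset.nodup_toList _) (Finset.nodup_toList _) ?_
          intro x hx hy
          simp at hx hy
          exact hy.2 hx
        · intro x
          rw [← List.mem_toFinset (l := L), hLM]
          have := @hT x
          simp
          tauto
      refine (h1.map v).symm.trans (List.Perm.of_eq ?_)
      rw [List.map_append]
      congr 1
      · rw [List.eq_replicate_iff]
        simpa [hTcard] using hbig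
      · rw [List.eq_replicate_iff]
        refine ⟨by simp [hUcard], ?_⟩
        intro b hb
        obtain ⟨x, hx, rfl⟩ := List.mem_map.mp hb
        exact hsmall x (Finset.mem_toList.mp hx)
    have heq : L.map v = List.replicate 3 4 ++ List.replicate 9 3 := by
      refine hperm.eq_of_pairwise (le := fun x y : ℚ => y ≤ x) ?_ ?_ ?_
      · intro a b _ _ h1 h2
        exact le_antisymm h2 h1
      · exact List.pairwise_map.mpr hsort
      · simp [List.replicate]
        try norm_num
    have hmap := map_foldl_ffd v τ L hnd [] (by simp)
    rw [heq] at hmap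
    have e3 : (3:ℚ) ≤ τ := by linarith
    have e4 : (4:ℚ) ≤ τ := by linarith
    have e6 : (3:ℚ) + 3 ≤ τ := by linarith
    have e8 : (4:ℚ) + 4 ≤ τ := by linarith
    have e9 : (3:ℚ) + 3 + 3 ≤ τ := by linarith
    have e12 : (4:ℚ) + 4 + 4 ≤ τ := by linarith
    have e12' : (3:ℚ) + 3 + 3 + 3 ≤ τ := by linarith
    have n1 : ¬ (4:ℚ) + 4 + 4 + 3 ≤ τ := by linarith
    have n2 : ¬ (3:ℚ) + 3 + 3 + 3 + 3 ≤ τ := by linarith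
    simp only [List.replicate, List.cons_append, List.nil_append, List.foldl_cons, List.foldl_nil,
      List.map_nil, costInsert, e3, e4, e6, e8, e9, e12, e12', n1, n2, if_true, if_false] at hmap
    have := congrArg List.length hmap
    simp at this
    unfold ffdBins at hlen
    omega
end

section
/- Let v be a bivalued cost function with values s < l ≤ τ on a finite set M of chores, let (P_1, P_2, …) be the bins produced by FFD(M, v, τ), and let (Q_1,…,Q_n) be a partition of M. Fix k ∈ [n] and suppose Q_i = P_i for all i < k, v(Q_k) ≤ τ, and |Q_k| > |P_k|. Then: (a) P_k contains strictly more large chores than Q_k; (b) Q_k contains at least two more small chores than P_k; (c) some bundle Q_z with z > k contains a large chore. -/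
open Finset

variable {α : Type*} [DecidableEq α]

lemma ffdInsert_spec (v : α → ℚ) (τ : ℚ) (c : α) (hc : v c ≤ τ) (bins : List (Finset α)) :
    ∃ j, (ffdInsert v τ c bins).getD j ∅ = insert c (bins.getD j ∅) ∧
      (∀ i, i ≠ j → (ffdInsert v τ c bins).getD i ∅ = bins.getD i ∅) ∧
      ∀ i, i < j → τ < bundleCost v (bins.getD i ∅) + v c := by
  induction bins with
  | nil =>
    refine ⟨0, ?_, ?_, ?_⟩
    · simp [ffdInsert, hc]
    · intro i hi
      cases i with
      | zero => exact absurd rfl hi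
      | succ i => simp [ffdInsert, hc]
    · intro i hi
      omega
  | cons B rest ih =>
    by_cases h : bundleCost v B + v c ≤ τ
    · refine ⟨0, ?_, ?_, ?_⟩
      · simp [ffdInsert, h]
      · intro i hi
        cases i with
        | zero => exact absurd rfl hi
        | succ i => simp [ffdInsert, h]
      · intro i hi
        omega
    · obtain ⟨j, h1, h2, h3⟩ := ih
      have he : ffdInsert v τ c (B :: rest) = B :: ffdInsert v τ c rest := by
        simp [ffdInsert, h]
      rw [he]
      refine ⟨j + 1, ?_, ?_, ?_⟩
      · simpa only [List.getD_cons_succ] using h1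
      · intro i hi
        cases i with
        | zero => simp only [List.getD_cons_zero]
        | succ i =>
          simp only [List.getD_cons_succ]
          exact h2 i (by omega)
      · intro i hi
        cases i with
        | zero =>
          simp only [List.getD_cons_zero]
          exact not_le.mp h
        | succ i =>
          simp only [List.getD_cons_succ]
          exact h3 i (by omega)

lemma ffdBins_spec (v : α → ℚ) (τ : ℚ) (L : List α) (hτ : ∀ c ∈ L, v c ≤ τ)
    (hn : L.Nodup) (hs : L.Pairwise fun c c' => v c' ≤ v c) :
    (∀ i, ∀ d ∈ (ffdBins v τ L).getD i ∅, d ∈ L) ∧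
    (∀ i j d, d ∈ (ffdBins v τ L).getD i ∅ → d ∈ (ffdBins v τ L).getD j ∅ → i = j) ∧
    (∀ k, ∀ c ∈ L, (∃ i, i < k ∧ c ∈ (ffdBins v τ L).getD i ∅) ∨
      c ∈ (ffdBins v τ L).getD k ∅ ∨
      ∃ T, T ⊆ (ffdBins v τ L).getD k ∅ ∧ (∀ d ∈ T, v c ≤ v d) ∧
        τ < bundleCost v T + v c) := by
  induction L using List.reverseRecOn with
  | nil => simp [ffdBins]
  | append_singleton L c ih =>
    have he : ffdBins v τ (L ++ [c]) = ffdInsert v τ c (ffdBins v τ L) := by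
      simp [ffdBins]
    rw [he]
    rw [List.nodup_append] at hn
    rw [List.pairwise_append] at hs
    obtain ⟨i1, i2, i3⟩ := ih (fun d hd => hτ d (by simp [hd])) hn.1 hs.1
    have hcL : c ∉ L := fun h => hn.2.2 c h c (by simp) rfl
    have hle : ∀ d ∈ L, v c ≤ v d := fun d hd => hs.2.2 d hd c (by simp)
    obtain ⟨j, h1, h2, h3⟩ := ffdInsert_spec v τ c (hτ c (by simp)) (ffdBins v τ L)
    generalize ffdInsert v τ c (ffdBins v τ L) = N at *
    generalize ffdBins v τ L = B at *
    have hmem : ∀ i d, d ∈ N.getD i ∅ ↔ (d ∈ B.getD i ∅ ∨ (d = c ∧ i = j)) := by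
      intro i d
      by_cases hij : i = j
      · subst hij
        rw [h1, Finset.mem_insert]
        tauto
      · rw [h2 i hij]
        tauto
    refine ⟨?_, ?_, ?_⟩
    · intro i d hd
      rcases (hmem i d).1 hd with h | h
      · exact List.mem_append_left _ (i1 i d h)
      · simp [h.1]
    · intro a b d ha hb
      rcases (hmem a d).1 ha with h | h <;> rcases (hmem b d).1 hb with h' | h'
      · exact i2 a b d h h'
      · exact absurd (h'.1 ▸ i1 a d h) hcL
      · exact absurd (h.1 ▸ i1 b d h') hcL
      · rw [h.2, h'.2]
    · intro k d hd
      rw [List.mem_append, List.mem_singleton] at hd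
      rcases hd with hd | rfl
      · rcases i3 k d hd with ⟨i, hi, hm⟩ | hm | ⟨T, hT, hT2, hT3⟩
        · exact Or.inl ⟨i, hi, (hmem i d).2 (Or.inl hm)⟩
        · exact Or.inr (Or.inl ((hmem k d).2 (Or.inl hm)))
        · exact Or.inr (Or.inr ⟨T, fun x hx => (hmem k x).2 (Or.inl (hT hx)), hT2, hT3⟩)
      · rcases lt_trichotomy j k with h | h | h
        · exact Or.inl ⟨j, h, (hmem j d).2 (Or.inr ⟨rfl, rfl⟩)⟩
        · exact Or.inr (Or.inl ((hmem k d).2 (Or.inr ⟨rfl, h.symm⟩)))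
        · exact Or.inr (Or.inr ⟨B.getD k ∅, fun x hx => (hmem k x).2 (Or.inl hx),
            fun x hx => hle x (i1 k x hx), h3 k h⟩)

lemma bivalued_counts (M : Finset α) (v : α → ℚ) (s l : ℚ) (hbv : Bivalued v M s l)
    (S : Finset α) (hS : S ⊆ M) :
    (S.filter (fun c => v c = l)).card + (S.filter (fun c => v c = s)).card = S.card ∧
    bundleCost v S = (S.filter (fun c => v c = l)).card * l
      + (S.filter (fun c => v c = s)).card * s := by
  obtain ⟨h0, hsl, hv⟩ := hbv
  have hf : S.filter (fun c => v c = s) = S.filter (fun c => ¬ v c = l) := by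
    apply Finset.filter_congr
    intro c hc
    rcases hv c (hS hc) with h | h
    · simp [h, hsl.ne]
    · simp [h, hsl.ne']
  constructor
  · rw [hf]
    exact Finset.card_filter_add_card_filter_not _
  · unfold bundleCost
    rw [← Finset.sum_filter_add_sum_filter_not S (fun c => v c = l), ← hf]
    congr 1
    · rw [Finset.sum_congr rfl (g := fun _ => l) (fun c hc => (Finset.mem_filter.1 hc).2)]
      simp
    · rw [Finset.sum_congr rfl (g := fun _ => s) (fun c hc => (Finset.mem_filter.1 hc).2)]
      simp

/-- if the partition `Q` agrees with the FFD bins before index `k`,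
`v(Q k) ≤ τ` and `|Q k| > |P k|`, then (a) `P k` has strictly more large chores than `Q k`;
(b) `Q k` has at least two more small chores than `P k`; (c) some later bundle of `Q`
contains a large chore. -/
theorem bivalued_two_small_chores
    (M : Finset α) (v : α → ℚ) (s l τ : ℚ)
    (hbv : Bivalued v M s l) (hlτ : l ≤ τ)
    (L : List α) (hL : IsFFDList v M L)
    (n : ℕ) (Q : Fin n → Finset α) (hQ : IsPartitionInto M n Q)
    (k : Fin n)
    (hprev : ∀ i : Fin n, i < k → Q i = (ffdBins v τ L).getD (i : ℕ) ∅)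
    (hQk : bundleCost v (Q k) ≤ τ)
    (hcard : ((ffdBins v τ L).getD (k : ℕ) ∅).card < (Q k).card) :
    ((Q k).filter (fun c => v c = l)).card
        < (((ffdBins v τ L).getD (k : ℕ) ∅).filter (fun c => v c = l)).card ∧
      (((ffdBins v τ L).getD (k : ℕ) ∅).filter (fun c => v c = s)).card + 2
        ≤ ((Q k).filter (fun c => v c = s)).card ∧
      ∃ z : Fin n, k < z ∧ ∃ c ∈ Q z, v c = l := by
  obtain ⟨hLM, hnd, hpw⟩ := hL
  have hbv' := hbv
  obtain ⟨h0, hsl, hv⟩ := hbv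
  have hτ : ∀ c ∈ L, v c ≤ τ := by
    intro c hc
    rcases hv c (hLM ▸ List.mem_toFinset.2 hc) with h | h <;> linarith
  obtain ⟨f1, f2, f3⟩ := ffdBins_spec v τ L hτ hnd hpw
  obtain ⟨q1, q2, q3⟩ := hQ
  have hPM : (ffdBins v τ L).getD (k : ℕ) ∅ ⊆ M := fun d hd =>
    hLM ▸ List.mem_toFinset.2 (f1 _ d hd)
  have hfit : ∀ c ∈ Q k, c ∉ (ffdBins v τ L).getD (k : ℕ) ∅ →
      ∃ T, T ⊆ (ffdBins v τ L).getD (k : ℕ) ∅ ∧ (∀ d ∈ T, v c ≤ v d) ∧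
        τ < bundleCost v T + v c := by
    intro c hc hcP
    have hcL : c ∈ L := by
      have := q1 k hc
      rw [← hLM] at this
      exact List.mem_toFinset.1 this
    rcases f3 k c hcL with ⟨i, hi, hm⟩ | hm | h
    · have hik : (⟨i, hi.trans k.2⟩ : Fin n) < k := hi
      have hm' : c ∈ Q ⟨i, hi.trans k.2⟩ := by
        rw [hprev _ hik]
        exact hm
      exact absurd hc (Finset.disjoint_left.1 (q2 _ _ hik.ne) hm')
    · exact absurd hm hcP
    · exact h
  have hlater : ∀ c ∈ (ffdBins v τ L).getD (k : ℕ) ∅, c ∉ Q k → ∃ z : Fin n, k < z ∧ c ∈ Q z := by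
    intro c hc hcQ
    obtain ⟨z, hz⟩ := q3 c (hPM hc)
    refine ⟨z, ?_, hz⟩
    rcases lt_trichotomy k z with h | h | h
    · exact h
    · subst h
      exact absurd hz hcQ
    · rw [hprev z h] at hz
      have := f2 _ _ _ hz hc
      exact absurd (Fin.ext this) h.ne
  generalize (ffdBins v τ L).getD (k : ℕ) ∅ = P at *
  obtain ⟨cP, bP⟩ := bivalued_counts M v s l hbv' P hPM
  obtain ⟨cQ, bQ⟩ := bivalued_counts M v s l hbv' (Q k) (q1 k)
  have hle : ((Q k).filter (fun c => v c = l)).card ≤ (P.filter (fun c => v c = l)).card := by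
    by_contra! hlt
    obtain ⟨c, hc, hcP⟩ := Finset.exists_mem_notMem_of_card_lt_card hlt
    rw [Finset.mem_filter] at hc hcP
    obtain ⟨T, hT, hT2, hT3⟩ := hfit c hc.1 (fun h => hcP ⟨h, hc.2⟩)
    have hTsub : T ⊆ P.filter (fun c => v c = l) := by
      intro d hd
      rw [Finset.mem_filter]
      refine ⟨hT hd, ?_⟩
      have := hT2 d hd
      rw [hc.2] at this
      rcases hv d (hPM (hT hd)) with h | h
      · linarith
      · exact h
    have hTc : bundleCost v T = T.card * l := by
      unfold bundleCost
      rw [Finset.sum_congr rfl (g := fun _ => l)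
        (fun c hc => (Finset.mem_filter.1 (hTsub hc)).2)]
      simp
    have hcard2 : T.card + 1 ≤ ((Q k).filter (fun c => v c = l)).card := by
      have := Finset.card_le_card hTsub
      omega
    have hq : (T.card : ℚ) + 1 ≤ ((Q k).filter (fun c => v c = l)).card := by
      exact_mod_cast hcard2
    have h4 := mul_le_mul_of_nonneg_right hq (h0.trans hsl).le
    have h5 : (0 : ℚ) ≤ ((Q k).filter (fun c => v c = s)).card * s := by positivity
    rw [hc.2, hTc] at hT3
    linarith
  have hlt : ((Q k).filter (fun c => v c = l)).card < (P.filter (fun c => v c = l)).card := by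
    refine lt_of_le_of_ne hle fun heq => ?_
    have hss : (P.filter (fun c => v c = s)).card < ((Q k).filter (fun c => v c = s)).card := by
      omega
    obtain ⟨c, hc, hcP⟩ := Finset.exists_mem_notMem_of_card_lt_card hss
    rw [Finset.mem_filter] at hc hcP
    obtain ⟨T, hT, hT2, hT3⟩ := hfit c hc.1 (fun h => hcP ⟨h, hc.2⟩)
    have hTP : bundleCost v T ≤ bundleCost v P := by
      unfold bundleCost
      refine Finset.sum_le_sum_of_subset_of_nonneg hT fun i hi _ => ?_
      rcases hv i (hPM hi) with h | h <;> linarith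
    have hq : ((P.filter (fun c => v c = s)).card : ℚ) + 1
        ≤ ((Q k).filter (fun c => v c = s)).card := by
      exact_mod_cast hss
    have h4 := mul_le_mul_of_nonneg_right hq h0.le
    rw [heq] at bQ
    rw [hc.2] at hT3
    linarith
  refine ⟨hlt, by omega, ?_⟩
  obtain ⟨c, hc, hcQ⟩ := Finset.exists_mem_notMem_of_card_lt_card hlt
  rw [Finset.mem_filter] at hc hcQ
  obtain ⟨z, hz, hcz⟩ := hlater c hc.1 (fun h => hcQ ⟨h, hc.2⟩)
  exact ⟨z, hz, c, hcz, hc.2⟩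
end
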